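/- Let {f_n} be a sequence of nonnegative measurable functions on a probability space (Ω, F, P) such that for every k ∈ ℕ the truncations f_n^{(k)} := f_n · 1_{{k−1 ≤ f_n < k}} converge hereditarily in Cesàro mean, P-a.e., to a measurable function f^{(k)} : Ω → [0, ∞), and set f := Σ_{k∈ℕ} f^{(k)}. Let B ⊇ {f = ∞} be a measurable set such that for every strictly increasing sequence of indices {m_j}, the Cesàro averages (1/J) Σ_{j=1}^J f_{m_j} tend to ∞, P-a.e. on B. Then at least one of the following holds: (i) there exist a measurable set C ⊇ B with P(C) > P(B) and a strictly increasing sequence of indices {n_j} such that for every further subsequence {m_i} of {f_{n_j}}, the Cesàro averages (1/I) Σ_{i=1}^I f_{m_i} tend to ∞, P-a.e. on C; or (ii) there exists a strictly increasing sequence of indices {n_j} such that for every further subsequence {m_i} of {f_{n_j}}, the Cesàro averages (1/I) Σ_{i=1}^I f_{m_i} converge to f, P-a.e. on Ω \ B. -/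

import Mathlib

open MeasureTheory Filter Finset
open scoped ENNReal

/-- The truncation `f^(k) = f · 1_{k-1 ≤ f < k}` of a function `f`. -/
noncomputable def trunc {Ω : Type*} (g : Ω → ℝ) (k : ℕ) : Ω → ℝ :=
  ({ω | (k : ℝ) - 1 ≤ g ω ∧ g ω < k}).indicator g

/-- A relation that holds frequently in its second argument and is antitone in its first one holds
along consecutive terms of every subsequence of a suitable sequence. -/
theorem exists_strictMono_forall_subseq_rel {C : ℕ → ℕ → Prop} (h : ∀ N, ∃ᶠ n in atTop, C N n)
    (hanti : ∀ ⦃M N n⦄, M ≤ N → C N n → C M n) :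
    ∃ ψ : ℕ → ℕ, StrictMono ψ ∧
      ∀ φ : ℕ → ℕ, StrictMono φ → ∀ j, C (ψ (φ j)) (ψ (φ (j + 1))) := by
  have hex : ∀ N, ∃ n, N < n ∧ C N n := fun N => by
    obtain ⟨n, hn, hC⟩ := (frequently_atTop.1 (h N)) (N + 1)
    exact ⟨n, hn, hC⟩
  choose g hg hgC using hex
  let ψ : ℕ → ℕ := fun n => g^[n] 0
  have hsucc : ∀ j, ψ (j + 1) = g (ψ j) := fun j => Function.iterate_succ_apply' g j 0
  have hψ : StrictMono ψ := strictMono_nat_of_lt_succ fun j => by rw [hsucc]; exact hg _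
  refine ⟨ψ, hψ, fun φ hφ j => ?_⟩
  have hlt : φ j < φ (j + 1) := hφ (Nat.lt_succ_self j)
  obtain ⟨b, hb⟩ : ∃ b, φ (j + 1) = b + 1 := ⟨φ (j + 1) - 1, by omega⟩
  rw [hb, hsucc]
  exact hanti (hψ.monotone (by omega)) (hgC _)

/-- Almost orthogonal square integrable functions have almost additive second moments. -/
theorem integral_sum_sq_le {Ω : Type*} [MeasurableSpace Ω] {μ : Measure Ω} {V : ℕ → Ω → ℝ}
    (hV : ∀ i, MemLp (V i) 2 μ) {e : ℕ → ℝ} (he : ∀ j, ∫ ω, V j ω ^ 2 ∂μ ≤ e j) {c : ℝ}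
    (hc : ∀ i j, i < j → |∫ ω, V i ω * V j ω ∂μ| ≤ c / j) (I : ℕ) :
    ∫ ω, (∑ i ∈ range I, V i ω) ^ 2 ∂μ ≤ ∑ j ∈ range I, (e j + 2 * |c|) := by
  induction I with
  | zero => simp
  | succ I ih =>
    have hS : MemLp (fun ω => ∑ i ∈ range I, V i ω) 2 μ :=
      memLp_finsetSum (range I) fun i _ => hV i
    have hVV : ∀ i, Integrable (fun ω => V i ω * V I ω) μ := fun i =>
      (hV i).integrable_mul (hV I)
    have hcross : ∫ ω, (∑ i ∈ range I, V i ω) * V I ω ∂μ ≤ |c| := by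
      simp_rw [sum_mul]
      rw [integral_finsetSum _ fun i _ => hVV i]
      calc ∑ i ∈ range I, ∫ ω, V i ω * V I ω ∂μ ≤ ∑ i ∈ range I, |c| / I :=
            sum_le_sum fun i hi => (le_abs_self _).trans <|
              (hc i I (mem_range.1 hi)).trans (by gcongr; exact le_abs_self c)
        _ ≤ |c| := by
            rw [sum_const, card_range, nsmul_eq_mul]
            rcases eq_or_ne I 0 with rfl | hI
            · simp
            · exact (mul_div_cancel₀ _ (Nat.cast_ne_zero.2 hI)).le
    have hexp : ∀ ω, (∑ i ∈ range (I + 1), V i ω) ^ 2 = (∑ i ∈ range I, V i ω) ^ 2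
        + (2 * ((∑ i ∈ range I, V i ω) * V I ω) + V I ω ^ 2) := fun ω => by
      rw [sum_range_succ]; ring
    have hint : Integrable (fun ω => (∑ i ∈ range I, V i ω) * V I ω) μ :=
      hS.integrable_mul (hV I)
    have hrest : Integrable
        (fun ω => 2 * ((∑ i ∈ range I, V i ω) * V I ω) + V I ω ^ 2) μ :=
      (hint.const_mul 2).add (hV I).integrable_sq
    simp_rw [hexp]
    rw [integral_add hS.integrable_sq hrest,
      integral_add (hint.const_mul 2) (hV I).integrable_sq, integral_const_mul, sum_range_succ]
    linarith [he I]

/-- If the integrals of nonnegative integrable functions are summable, the functions tend to zero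
almost everywhere. -/
theorem ae_tendsto_zero_of_summable_integral {Ω : Type*} [MeasurableSpace Ω] {μ : Measure Ω}
    {Z : ℕ → Ω → ℝ} (hZ : ∀ n, Integrable (Z n) μ) (hpos : ∀ n ω, 0 ≤ Z n ω)
    (hsum : Summable fun n => ∫ ω, Z n ω ∂μ) :
    ∀ᵐ ω ∂μ, Tendsto (fun n => Z n ω) atTop (nhds 0) := by
  have hlin : ∫⁻ ω, ∑' n, ENNReal.ofReal (Z n ω) ∂μ ≠ ∞ := by
    rw [lintegral_tsum fun n => (hZ n).aemeasurable.ennreal_ofReal]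
    have : ∀ n, ∫⁻ ω, ENNReal.ofReal (Z n ω) ∂μ = ENNReal.ofReal (∫ ω, Z n ω ∂μ) := fun n =>
      (ofReal_integral_eq_lintegral_ofReal (hZ n) (ae_of_all _ (hpos n))).symm
    simp_rw [this]
    exact hsum.tsum_ofReal_ne_top
  filter_upwards [ae_lt_top' (AEMeasurable.tsum
    fun n => (hZ n).aemeasurable.ennreal_ofReal) hlin] with ω hω
  have := (ENNReal.tendsto_toReal ENNReal.zero_ne_top).comp
    (ENNReal.tendsto_atTop_zero_of_tsum_ne_top hω.ne)
  simpa [Function.comp_def, ENNReal.toReal_ofReal (hpos _ ω)] using this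

/-- Etemadi's argument: Cesàro means of nonnegative functions converge almost everywhere as soon
as the centred partial sums satisfy a summable second moment bound. -/
theorem ae_tendsto_cesaro_of_integral_sq_le {Ω : Type*} [MeasurableSpace Ω] {μ : Measure Ω}
    {W T : ℕ → Ω → ℝ} {L : Ω → ℝ} (hW : ∀ i, MemLp (W i) 2 μ) (hT : ∀ i, MemLp (T i) 2 μ)
    (hWpos : ∀ i ω, 0 ≤ W i ω)
    (hTL : ∀ᵐ ω ∂μ, Tendsto (fun i => T i ω) atTop (nhds (L ω)))
    {e : ℕ → ℝ} (he : ∀ j, 0 ≤ e j) (hsum : Summable fun j : ℕ => e j / ((j : ℝ) + 1) ^ 2)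
    (hbound : ∀ I, ∫ ω, (∑ i ∈ range I, (W i ω - T i ω)) ^ 2 ∂μ ≤ ∑ j ∈ range I, e j) :
    ∀ᵐ ω ∂μ, Tendsto (fun I : ℕ => (∑ i ∈ range I, W i ω) / I) atTop (nhds (L ω)) := by
  have hV : ∀ I, MemLp (fun ω => ∑ i ∈ range I, (W i ω - T i ω)) 2 μ := fun I =>
    memLp_finsetSum (range I) fun i _ => (hW i).sub (hT i)
  have key : ∀ c : ℝ, 1 < c → ∀ᵐ ω ∂μ, Tendsto (fun k : ℕ =>
      (∑ i ∈ range ⌊c ^ k⌋₊, (W i ω - T i ω)) / (⌊c ^ k⌋₊ : ℝ)) atTop (nhds 0) := by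
    intro c hc
    have hZ := ae_tendsto_zero_of_summable_integral (μ := μ)
      (Z := fun k ω => (1 / (⌊c ^ k⌋₊ : ℝ) ^ 2) * (∑ i ∈ range ⌊c ^ k⌋₊, (W i ω - T i ω)) ^ 2)
      (fun k => (hV _).integrable_sq.const_mul _) (fun k ω => by positivity) ?_
    · filter_upwards [hZ] with ω hω
      have h2 := hω.sqrt
      rw [Real.sqrt_zero] at h2
      refine squeeze_zero_norm (fun k => ?_) h2
      rw [Real.norm_eq_abs, ← Real.sqrt_sq_eq_abs]
      exact Real.sqrt_le_sqrt (le_of_eq (by ring))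
    · set K := c ^ 5 * (c - 1)⁻¹ ^ 3 with hK
      have hKpos : 0 ≤ K := by have : 0 < c - 1 := by linarith
                               positivity
      refine summable_of_sum_range_le (c := ∑' j : ℕ, 4 * K * (e j / ((j : ℝ) + 1) ^ 2))
        (fun k => integral_nonneg fun ω => by positivity) fun N => ?_
      calc ∑ k ∈ range N, ∫ ω, (1 / (⌊c ^ k⌋₊ : ℝ) ^ 2)
              * (∑ i ∈ range ⌊c ^ k⌋₊, (W i ω - T i ω)) ^ 2 ∂μ
          ≤ ∑ k ∈ range N, ∑ j ∈ range ⌊c ^ N⌋₊,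
              (if j < ⌊c ^ k⌋₊ then 1 / (⌊c ^ k⌋₊ : ℝ) ^ 2 else 0) * e j := by
            refine sum_le_sum fun k hk => ?_
            rw [integral_const_mul]
            calc _ ≤ (1 / (⌊c ^ k⌋₊ : ℝ) ^ 2) * ∑ j ∈ range ⌊c ^ k⌋₊, e j := by
                  gcongr; exact hbound _
              _ = ∑ j ∈ range ⌊c ^ k⌋₊,
                    (if j < ⌊c ^ k⌋₊ then 1 / (⌊c ^ k⌋₊ : ℝ) ^ 2 else 0) * e j := by
                  rw [mul_sum]
                  refine sum_congr rfl fun j hj => ?_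
                  rw [if_pos (mem_range.1 hj)]
              _ ≤ _ := by
                  refine sum_le_sum_of_subset_of_nonneg ?_ fun j _ _ => ?_
                  · refine range_subset_range.2 (Nat.floor_mono ?_)
                    exact pow_le_pow_right₀ hc.le (mem_range.1 hk).le
                  · have := he j
                    split_ifs <;> positivity
        _ = ∑ j ∈ range ⌊c ^ N⌋₊, (∑ k ∈ range N with ((j : ℝ) + 1 / 2) < ⌊c ^ k⌋₊,
              1 / (⌊c ^ k⌋₊ : ℝ) ^ 2) * e j := by
            rw [sum_comm]
            refine sum_congr rfl fun j _ => ?_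
            rw [← sum_mul, sum_filter]
            congr 1
            refine sum_congr rfl fun k _ => ?_
            have : ((j : ℝ) + 1 / 2 < ⌊c ^ k⌋₊) ↔ j < ⌊c ^ k⌋₊ := by
              constructor
              · intro h
                have : (j : ℝ) < ⌊c ^ k⌋₊ := by linarith
                exact_mod_cast this
              · intro h
                have : (j : ℝ) + 1 ≤ ⌊c ^ k⌋₊ := by exact_mod_cast h
                linarith
            simp only [this]
        _ ≤ ∑ j ∈ range ⌊c ^ N⌋₊, 4 * K * (e j / ((j : ℝ) + 1) ^ 2) := by
            refine sum_le_sum fun j _ => ?_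
            have h1 := sum_div_nat_floor_pow_sq_le_div_sq N
              (show (0 : ℝ) < (j : ℝ) + 1 / 2 by positivity) hc
            calc _ ≤ (K / ((j : ℝ) + 1 / 2) ^ 2) * e j := by
                  have := he j
                  gcongr
              _ ≤ (K / (((j : ℝ) + 1) / 2) ^ 2) * e j := by
                  have := he j
                  gcongr
                  linarith
              _ = _ := by field_simp; ring
        _ ≤ _ := Summable.sum_le_tsum _ (fun j _ => by have := he j; positivity)
            (hsum.mul_left _)
  obtain ⟨c, -, hc1, hclim⟩ := exists_seq_strictAnti_tendsto (1 : ℝ)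
  filter_upwards [hTL, ae_all_iff.2 fun n => key (c n) (hc1 n)] with ω hT hω
  refine tendsto_div_of_monotone_of_tendsto_div_floor_pow _ _ ?_ c hc1 hclim fun n => ?_
  · exact monotone_nat_of_le_succ fun m => by
      rw [sum_range_succ]; linarith [hWpos m ω]
  · have hfl : Tendsto (fun k : ℕ => ⌊c n ^ k⌋₊) atTop atTop :=
      tendsto_nat_floor_atTop.comp (tendsto_pow_atTop_atTop_of_one_lt (hc1 n))
    have h2 := (hω n).add (hT.cesaro.comp hfl)
    rw [zero_add] at h2
    refine h2.congr fun k => ?_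
    simp only [Function.comp_apply, sum_sub_distrib]
    ring

/-- A bounded sequence in a Hilbert space has a weak cluster point, tested on finite sets. -/
theorem exists_weak_cluster {E : Type*} [NormedAddCommGroup E] [InnerProductSpace ℝ E]
    [CompleteSpace E] {u : ℕ → E} {R : ℝ} (hu : ∀ n, ‖u n‖ ≤ R) :
    ∃ γ : E, ∀ s : Finset E, ∀ ε > 0,
      ∃ᶠ n in atTop, ∀ h ∈ s, |inner ℝ h (u n - γ)| < ε := by
  let d : ℕ → WeakDual ℝ E := fun n =>
    StrongDual.toWeakDual (InnerProductSpace.toDual ℝ E (u n))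
  obtain ⟨x, -, hx⟩ := (WeakDual.isCompact_closedBall (𝕜 := ℝ) (E := E) 0 R).exists_mapClusterPt
    (f := atTop) (u := d) (by
      refine tendsto_principal.2 (Eventually.of_forall fun n => ?_)
      rw [Set.mem_preimage, mem_closedBall_zero_iff]
      exact (LinearIsometryEquiv.norm_map (InnerProductSpace.toDual ℝ E) (u n)).trans_le (hu n))
  refine ⟨(InnerProductSpace.toDual ℝ E).symm (WeakDual.toStrongDual x), fun s ε hε => ?_⟩
  have hev : ∀ᶠ y : WeakDual ℝ E in nhds x, ∀ h ∈ s, |y h - x h| < ε := by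
    refine (eventually_all_finset s).2 fun h _ => ?_
    have hc : Continuous fun y : WeakDual ℝ E => |y h - x h| :=
      ((WeakDual.eval_continuous h).sub continuous_const).abs
    exact hc.continuousAt.eventually_lt continuousAt_const (by simpa using hε)
  refine (hx.frequently hev).mono fun n hn h hh => ?_
  have h1 : inner ℝ ((InnerProductSpace.toDual ℝ E).symm (WeakDual.toStrongDual x)) h = x h :=
    InnerProductSpace.toDual_symm_apply
  have h2 : d n h = inner ℝ (u n) h := rfl
  have := hn h hh
  rwa [h2, ← h1, ← inner_sub_left, real_inner_comm] at this

theorem inner_toLp_eq_integral {Ω : Type*} [MeasurableSpace Ω] {μ : Measure Ω} {f g : Ω → ℝ}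
    (hf : MemLp f 2 μ) (hg : MemLp g 2 μ) :
    inner ℝ (hf.toLp f) (hg.toLp g) = ∫ ω, f ω * g ω ∂μ := by
  rw [L2.inner_def]
  refine integral_congr_ae ?_
  filter_upwards [hf.coeFn_toLp, hg.coeFn_toLp] with ω h1 h2
  rw [h1, h2]
  simp [mul_comm]

/-- A sequence of measurable sets has a subsequence whose indicator functions converge
hereditarily in Cesàro mean. -/
theorem exists_subseq_cesaro_indicator {Ω : Type*} [MeasurableSpace Ω] (μ : Measure Ω)
    [IsFiniteMeasure μ] {G : ℕ → Set Ω} (hG : ∀ n, MeasurableSet (G n)) {A : Set Ω}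
    (hA : MeasurableSet A) {ε : ℝ} (hε : ∀ n, ε ≤ μ.real (A ∩ G n)) :
    ∃ γ : Ω → ℝ, Measurable γ ∧ ε ≤ ∫ ω in A, γ ω ∂μ ∧ ∃ ψ : ℕ → ℕ, StrictMono ψ ∧
      ∀ φ : ℕ → ℕ, StrictMono φ → ∀ᵐ ω ∂μ, Tendsto (fun I : ℕ =>
        (∑ i ∈ range I, (G (ψ (φ i))).indicator (fun _ => (1 : ℝ)) ω) / I) atTop
        (nhds (γ ω)) := by
  let w : ℕ → Ω → ℝ := fun n => (G n).indicator fun _ => 1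
  have hw : ∀ n, MemLp (w n) 2 μ := fun n => (memLp_const (1 : ℝ)).indicator (hG n)
  let R : ℝ := ‖(memLp_const (1 : ℝ) : MemLp (fun _ : Ω => (1 : ℝ)) 2 μ).toLp _‖
  have hR : ∀ n, ‖(hw n).toLp (w n)‖ ≤ R := fun n => by
    refine Lp.norm_le_norm_of_ae_le ?_
    filter_upwards [(hw n).coeFn_toLp,
      (memLp_const (1 : ℝ) : MemLp (fun _ : Ω => (1 : ℝ)) 2 μ).coeFn_toLp] with ω h1 h2
    rw [h1, h2]
    exact norm_indicator_le_norm_self (fun _ => (1 : ℝ)) ω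
  obtain ⟨γ, hγ⟩ := exists_weak_cluster hR
  have hγm : MemLp γ 2 μ := Lp.memLp γ
  have hV : ∀ n, MemLp (w n - ⇑γ) 2 μ := fun n => (hw n).sub hγm
  have hVeq : ∀ n, (hV n).toLp (w n - ⇑γ) = (hw n).toLp (w n) - γ := fun n => by
    rw [MemLp.toLp_sub (hw n) hγm, Lp.toLp_coeFn]
  have h1A : MemLp (A.indicator fun _ => (1 : ℝ)) 2 μ := (memLp_const (1 : ℝ)).indicator hA
  classical
  obtain ⟨ψ, hψ, hψφ⟩ := exists_strictMono_forall_subseq_rel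
    (C := fun N n => (∀ m ≤ N, |inner ℝ ((hw m).toLp (w m)) ((hw n).toLp (w n) - γ)|
        ≤ 1 / ((N : ℝ) + 1)) ∧ |inner ℝ γ ((hw n).toLp (w n) - γ)| ≤ 1 / ((N : ℝ) + 1))
    (fun N => by
      refine (hγ (insert γ ((range (N + 1)).image fun m => (hw m).toLp (w m)))
        (1 / ((N : ℝ) + 1)) (by positivity)).mono fun n hn => ⟨fun m hm => (hn _ ?_).le,
          (hn _ (mem_insert_self _ _)).le⟩
      exact mem_insert_of_mem (mem_image_of_mem _ (mem_range.2 (by omega))))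
    (fun M N n hMN h => by
      have hle : 1 / ((N : ℝ) + 1) ≤ 1 / ((M : ℝ) + 1) := by gcongr
      exact ⟨fun m hm => (h.1 m (hm.trans hMN)).trans hle, h.2.trans hle⟩)
  refine ⟨γ, (Lp.stronglyMeasurable γ).measurable, ?_, ψ, hψ, fun φ hφ => ?_⟩
  · refine le_of_forall_pos_le_add fun η hη => ?_
    obtain ⟨n, hn⟩ := (hγ {h1A.toLp _} η hη).exists
    have h1 := hn _ (mem_singleton_self _)
    rw [← hVeq, inner_toLp_eq_integral] at h1
    have h2 : ∀ ω, A.indicator (fun _ => (1 : ℝ)) ω * (w n - ⇑γ) ω =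
        A.indicator (fun ω => w n ω - γ ω) ω := fun ω => by
      by_cases h : ω ∈ A <;> simp [h]
    simp_rw [h2] at h1
    rw [integral_indicator hA, integral_sub ((hw n).integrable one_le_two).integrableOn
      (hγm.integrable one_le_two).integrableOn, integral_indicator_const _ (hG n),
      measureReal_restrict_apply (hG n), Set.inter_comm, smul_eq_mul, mul_one] at h1
    have := (abs_lt.1 h1).2
    linarith [hε n]
  · have hn : ∀ j, j ≤ ψ (φ j) := fun j => (hψ.comp hφ).le_apply
    refine ae_tendsto_cesaro_of_integral_sq_le (W := fun i => w (ψ (φ i))) (T := fun _ => γ)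
      (L := γ) (e := fun _ => (R + ‖γ‖) ^ 2 + 2 * |(2 : ℝ)|) (fun i => hw _) (fun _ => hγm)
      (fun i ω => Set.indicator_nonneg (fun _ _ => zero_le_one) ω)
      (ae_of_all _ fun ω => tendsto_const_nhds) (fun j => by positivity) ?_ fun I => ?_
    · have := ((summable_nat_add_iff 1).2 (Real.summable_one_div_nat_pow.2 one_lt_two)).mul_left
        ((R + ‖γ‖) ^ 2 + 2 * |(2 : ℝ)|)
      refine this.congr fun j => ?_
      push_cast
      ring
    · refine integral_sum_sq_le (V := fun i => w (ψ (φ i)) - ⇑γ) (fun i => hV _) (fun j => ?_)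
        (c := 2) (fun i j hij => ?_) I
      · have h1 := inner_toLp_eq_integral (hV (ψ (φ j))) (hV (ψ (φ j)))
        rw [real_inner_self_eq_norm_sq, hVeq] at h1
        simp_rw [pow_two ((w (ψ (φ j)) - ⇑γ) _)]
        rw [← h1]
        gcongr
        exact (norm_sub_le _ _).trans (by gcongr; exact hR _)
      · obtain ⟨j, rfl⟩ : ∃ b, j = b + 1 := ⟨j - 1, by omega⟩
        rw [← inner_toLp_eq_integral (hV _) (hV _), hVeq, hVeq, inner_sub_left]
        obtain ⟨h1, h2⟩ := hψφ φ hφ j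
        have h3 := h1 (ψ (φ i)) ((hψ.comp hφ).monotone (by omega))
        have h4 : 1 / ((ψ (φ j) : ℝ) + 1) ≤ 1 / ((j : ℝ) + 1) := by
          gcongr
          exact_mod_cast hn j
        calc _ ≤ 1 / ((ψ (φ j) : ℝ) + 1) + 1 / ((ψ (φ j) : ℝ) + 1) :=
              (abs_sub _ _).trans (add_le_add h3 h2)
          _ ≤ 1 / ((j : ℝ) + 1) + 1 / ((j : ℝ) + 1) := add_le_add h4 h4
          _ = _ := by push_cast; ring

/-- If nonnegative functions are not bounded in probability on a set `A`, then the Cesàro means of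
a subsequence diverge hereditarily on a set that charges `A`. -/
theorem exists_subseq_cesaro_tendsto_atTop {Ω : Type*} [MeasurableSpace Ω] (μ : Measure Ω)
    [IsFiniteMeasure μ] {f : ℕ → Ω → ℝ} (hmeas : ∀ n, Measurable (f n))
    (hpos : ∀ n ω, 0 ≤ f n ω) {A : Set Ω} (hA : MeasurableSet A) {ε : ℝ} (hε : 0 < ε)
    (hf : ∀ K : ℕ, ∃ᶠ n in atTop, ε ≤ μ.real (A ∩ {ω | (K : ℝ) ≤ f n ω})) :
    ∃ D : Set Ω, MeasurableSet D ∧ 0 < μ (A ∩ D) ∧ ∃ n : ℕ → ℕ, StrictMono n ∧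
      ∀ φ : ℕ → ℕ, StrictMono φ → ∀ᵐ ω ∂μ, ω ∈ D →
        Tendsto (fun I : ℕ => (∑ i ∈ range I, f (n (φ i)) ω) / I) atTop atTop := by
  obtain ⟨p, hp, hpε⟩ := extraction_forall_of_frequently hf
  have hG : ∀ j : ℕ, MeasurableSet {ω | (j : ℝ) ≤ f (p j) ω} := fun j =>
    measurableSet_le measurable_const (hmeas _)
  obtain ⟨γ, hγm, hγε, ψ, hψ, hψφ⟩ := exists_subseq_cesaro_indicator μ hG hA hpε
  refine ⟨{ω | 0 < γ ω}, measurableSet_lt measurable_const hγm, ?_, p ∘ ψ, hp.comp hψ,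
    fun φ hφ => ?_⟩
  · rw [pos_iff_ne_zero]
    intro h0
    have : ∫ ω in A, γ ω ∂μ ≤ 0 := by
      refine integral_nonpos_of_ae ?_
      rw [Filter.EventuallyLE, ae_restrict_iff' hA, ae_iff]
      convert h0 using 2
      ext ω
      simp
    linarith
  · filter_upwards [hψφ φ hφ] with ω hω hD
    refine tendsto_atTop.2 fun b => ?_
    obtain ⟨M, hM⟩ := exists_nat_gt ((b + 1) / γ ω)
    have hD' : 0 < γ ω := hD
    rw [div_lt_iff₀ hD'] at hM
    have hlim : Tendsto (fun I : ℕ => M * ((∑ i ∈ range I,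
        ({ω | ((ψ (φ i) : ℕ) : ℝ) ≤ f (p (ψ (φ i))) ω}).indicator (fun _ => (1 : ℝ)) ω) / I)
        - (M : ℝ) * M / I) atTop (nhds (M * γ ω - 0)) :=
      (hω.const_mul (M : ℝ)).sub (tendsto_const_div_atTop_nhds_zero_nat _)
    filter_upwards [hlim.eventually (lt_mem_nhds (show b < M * γ ω - 0 by linarith))] with I hI
    refine hI.le.trans ?_
    rw [← mul_div_assoc, ← sub_div]
    gcongr
    have hterm : ∀ i, (M : ℝ) * ({ω | ((ψ (φ i) : ℕ) : ℝ) ≤ f (p (ψ (φ i))) ω}).indicator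
        (fun _ => (1 : ℝ)) ω ≤ f (p (ψ (φ i))) ω + if i < M then (M : ℝ) else 0 := fun i => by
      have h0 := hpos (p (ψ (φ i))) ω
      by_cases hmem : ω ∈ {ω | ((ψ (φ i) : ℕ) : ℝ) ≤ f (p (ψ (φ i))) ω}
      · rw [Set.indicator_of_mem hmem, mul_one]
        split_ifs with hi
        · linarith
        · rw [add_zero]
          refine le_trans ?_ hmem
          exact_mod_cast (not_lt.1 hi).trans (hψ.comp hφ).le_apply
      · rw [Set.indicator_of_notMem hmem, mul_zero]
        split_ifs <;> positivity
    have hfew : ∑ i ∈ range I, (if i < M then (M : ℝ) else 0) ≤ M * M := by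
      rw [← sum_filter, sum_const, nsmul_eq_mul]
      gcongr
      refine (card_le_card (t := range M) fun i hi => ?_).trans_eq (card_range M)
      exact mem_range.2 (mem_filter.1 hi).2
    have hsum := sum_le_sum fun i (_ : i ∈ range I) => hterm i
    rw [← mul_sum, sum_add_distrib] at hsum
    simp only [Function.comp_apply]
    linarith

theorem trunc_succ_apply {Ω : Type*} {g : Ω → ℝ} {ω : Ω} (hg : 0 ≤ g ω) (k : ℕ) :
    trunc g (k + 1) ω = if k = ⌊g ω⌋₊ then g ω else 0 := by
  rw [trunc, Set.indicator_apply]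
  refine if_congr ?_ rfl rfl
  rw [eq_comm, Nat.floor_eq_iff hg, Set.mem_ofPred_eq]
  push_cast
  rw [add_sub_cancel_right]

theorem measurable_trunc {Ω : Type*} [MeasurableSpace Ω] {g : Ω → ℝ} (hg : Measurable g) (k : ℕ) :
    Measurable (trunc g k) :=
  hg.indicator ((measurableSet_le measurable_const hg).inter (measurableSet_lt hg measurable_const))

theorem trunc_succ_nonneg {Ω : Type*} {g : Ω → ℝ} {ω : Ω} (hg : 0 ≤ g ω) (k : ℕ) :
    0 ≤ trunc g (k + 1) ω := by
  rw [trunc_succ_apply hg]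
  split_ifs <;> simp [hg]

theorem trunc_succ_le {Ω : Type*} {g : Ω → ℝ} {ω : Ω} (hg : 0 ≤ g ω) (k : ℕ) :
    trunc g (k + 1) ω ≤ k + 1 := by
  rw [trunc_succ_apply hg]
  split_ifs with h
  · rw [h]; exact (Nat.lt_floor_add_one _).le
  · positivity

/-- The part of `g` below the level `i`, as a sum of truncations. -/
noncomputable def truncBelow {Ω : Type*} (g : Ω → ℝ) (i : ℕ) (ω : Ω) : ℝ :=
  ∑ k ∈ range i, trunc g (k + 1) ω

theorem truncBelow_apply {Ω : Type*} {g : Ω → ℝ} {ω : Ω} (hg : 0 ≤ g ω) (i : ℕ) :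
    truncBelow g i ω = if g ω < i then g ω else 0 := by
  simp_rw [truncBelow, trunc_succ_apply hg, sum_ite_eq', mem_range, Nat.floor_lt hg]

theorem measurable_truncBelow {Ω : Type*} [MeasurableSpace Ω] {g : Ω → ℝ} (hg : Measurable g)
    (i : ℕ) : Measurable (truncBelow g i) :=
  Finset.measurable_fun_sum _ fun k _ => measurable_trunc hg (k + 1)

theorem truncBelow_nonneg {Ω : Type*} {g : Ω → ℝ} {ω : Ω} (hg : 0 ≤ g ω) (i : ℕ) :
    0 ≤ truncBelow g i ω :=
  sum_nonneg fun k _ => trunc_succ_nonneg hg k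

theorem truncBelow_le {Ω : Type*} {g : Ω → ℝ} {ω : Ω} (hg : 0 ≤ g ω) (i : ℕ) :
    truncBelow g i ω ≤ i := by
  rw [truncBelow_apply hg]
  split_ifs with h
  · exact h.le
  · positivity

theorem truncBelow_sq_le {Ω : Type*} {g : Ω → ℝ} {ω : Ω} (hg : 0 ≤ g ω) (i : ℕ) :
    truncBelow g i ω ^ 2 ≤ ∑ k ∈ range i, ((k : ℝ) + 1) * trunc g (k + 1) ω := by
  rw [truncBelow_apply hg]
  simp_rw [trunc_succ_apply hg, mul_ite, mul_zero, sum_ite_eq', mem_range, Nat.floor_lt hg]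
  split_ifs with h
  · rw [pow_two]
    gcongr
    exact (Nat.lt_floor_add_one _).le
  · simp

/-- A bounded real sequence that converges hereditarily in Cesàro mean converges. -/
theorem tendsto_of_hereditary_cesaro {x : ℕ → ℝ} {R c : ℝ} (hx : ∀ n, |x n| ≤ R)
    (h : ∀ φ : ℕ → ℕ, StrictMono φ →
      Tendsto (fun J : ℕ => (∑ j ∈ range J, x (φ j)) / J) atTop (nhds c)) :
    Tendsto x atTop (nhds c) := by
  refine tendsto_of_subseq_tendsto fun ns hns => ?_
  obtain ⟨p, hp, hnp⟩ := strictMono_subseq_of_tendsto_atTop hns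
  obtain ⟨y, -, q, hq, hy⟩ := tendsto_subseq_of_bounded
    (Metric.isBounded_closedBall (x := (0 : ℝ)) (r := R))
    (x := fun j => x (ns (p j))) (fun n => by simpa using hx _)
  have h1 := h _ (hnp.comp hq)
  have h2 := hy.cesaro
  have : y = c := tendsto_nhds_unique h2 (h1.congr fun J => by
    rw [div_eq_inv_mul]; rfl)
  exact ⟨p ∘ q, this ▸ hy⟩

/-- Hereditary Cesàro convergence of a bounded sequence implies weak convergence. -/
theorem tendsto_integral_mul_of_hereditary_cesaro {Ω : Type*} [MeasurableSpace Ω] {μ : Measure Ω}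
    {g : ℕ → Ω → ℝ} {G : Ω → ℝ} (hg : ∀ n, AEStronglyMeasurable (g n) μ) {R : ℝ}
    (hR : ∀ n, ∀ᵐ ω ∂μ, |g n ω| ≤ R)
    (hG : ∀ φ : ℕ → ℕ, StrictMono φ → ∀ᵐ ω ∂μ,
      Tendsto (fun J : ℕ => (∑ j ∈ range J, g (φ j) ω) / J) atTop (nhds (G ω)))
    {h : Ω → ℝ} (hh : Integrable h μ) :
    Tendsto (fun n => ∫ ω, h ω * g n ω ∂μ) atTop (nhds (∫ ω, h ω * G ω ∂μ)) := by
  have hint : ∀ n, Integrable (fun ω => h ω * g n ω) μ := fun n => hh.mul_bdd (hg n) (hR n)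
  refine tendsto_of_hereditary_cesaro (R := ∫ ω, |h ω| * R ∂μ) (fun n => ?_) fun φ hφ => ?_
  · refine (abs_integral_le_integral_abs).trans
      (integral_mono_ae (hint n).abs (hh.abs.mul_const R) ?_)
    filter_upwards [hR n] with ω hω
    rw [abs_mul]
    gcongr
  · have hlim := tendsto_integral_of_dominated_convergence (μ := μ)
      (F := fun (J : ℕ) ω => h ω * ((∑ j ∈ range J, g (φ j) ω) / J))
      (f := fun ω => h ω * G ω) (fun ω => |h ω| * R) (fun J => ?_) (hh.abs.mul_const R)
      (fun J => ?_) ?_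
    · refine hlim.congr fun J => ?_
      rw [← integral_finsetSum _ fun j _ => hint (φ j), ← integral_div]
      refine integral_congr_ae (ae_of_all _ fun ω => ?_)
      simp only [← mul_sum]
      ring
    · simp_rw [div_eq_mul_inv]
      exact hh.aestronglyMeasurable.mul
        ((Finset.aestronglyMeasurable_fun_sum _ fun j _ => hg (φ j)).mul_const _)
    · filter_upwards [ae_all_iff.2 hR] with ω hω
      rw [norm_mul, Real.norm_eq_abs, Real.norm_eq_abs]
      have hR0 : 0 ≤ R := (abs_nonneg _).trans (hω 0)
      gcongr
      rw [abs_div, Nat.abs_cast]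
      refine div_le_of_le_mul₀ (by positivity) hR0 ((abs_sum_le_sum_abs _ _).trans ?_)
      refine (sum_le_sum fun j _ => hω (φ j)).trans_eq ?_
      rw [sum_const, card_range, nsmul_eq_mul, mul_comm]
    · filter_upwards [hG φ hφ] with ω hω using hω.const_mul _

theorem summable_sum_range_mul_div_sq {a : ℕ → ℝ} (ha : ∀ k, 0 ≤ a k) (hsum : Summable a) :
    Summable fun i : ℕ => (∑ k ∈ range i, ((k : ℝ) + 1) * a k) / ((i : ℝ) + 1) ^ 2 := by
  refine summable_of_sum_range_le (c := ∑' k, 2 * a k) (fun i => ?_) fun M => ?_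
  · exact div_nonneg (sum_nonneg fun k _ => mul_nonneg (by positivity) (ha k)) (by positivity)
  · calc ∑ i ∈ range M, (∑ k ∈ range i, ((k : ℝ) + 1) * a k) / ((i : ℝ) + 1) ^ 2
        = ∑ k ∈ range M, ∑ i ∈ Ioo k M, ((k : ℝ) + 1) * a k / ((i : ℝ) + 1) ^ 2 := by
          simp_rw [sum_div]
          refine sum_comm' fun i k => ?_
          simp only [mem_range, mem_Ioo]
          omega
      _ ≤ ∑ k ∈ range M, ((k : ℝ) + 1) * a k * (2 / ((k : ℝ) + 1)) := by
          refine sum_le_sum fun k _ => ?_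
          simp_rw [div_eq_mul_inv (((k : ℝ) + 1) * a k)]
          rw [← mul_sum]
          have hk := ha k
          gcongr
          refine le_trans (sum_le_sum fun i hi => ?_) (sum_Ioo_inv_sq_le k M)
          have hi0 : (0 : ℝ) < i := by
            exact_mod_cast (Nat.zero_le k).trans_lt (mem_Ioo.1 hi).1
          gcongr
          linarith
      _ = ∑ k ∈ range M, 2 * a k := sum_congr rfl fun k _ => by field_simp
      _ ≤ _ := (hsum.mul_left 2).sum_le_tsum _ fun k _ => mul_nonneg zero_le_two (ha k)

theorem exists_summable_sum_Ico_div_le {a : ℕ → ℝ} (ha : ∀ k, 0 ≤ a k) (hsum : Summable a) :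
    ∃ d : ℕ → ℝ, Summable d ∧ ∀ i K : ℕ, 1 ≤ i → ∑ k ∈ Ico i K, a k / k ≤ d i := by
  let G : ℕ × ℕ → ℝ := fun p => if 1 ≤ p.2 ∧ p.2 ≤ p.1 then a p.1 / p.1 else 0
  have hG0 : 0 ≤ G := fun p => by
    have := ha p.1
    simp only [G]
    split_ifs
    · exact div_nonneg this (Nat.cast_nonneg _)
    · exact le_rfl
  have hsupp : ∀ k, ∀ i ∉ Icc 1 k, G (k, i) = 0 := fun k i hi => by
    rw [mem_Icc] at hi
    exact if_neg hi
  have hGsum : Summable G := by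
    refine (summable_prod_of_nonneg hG0).2 ⟨fun k => summable_of_ne_finset_zero (hsupp k), ?_⟩
    refine hsum.of_nonneg_of_le (fun k => tsum_nonneg fun i => hG0 _) fun k => ?_
    rw [tsum_eq_sum (hsupp k)]
    calc ∑ i ∈ Icc 1 k, G (k, i) = ∑ i ∈ Icc 1 k, a k / k :=
          sum_congr rfl fun i hi => if_pos (mem_Icc.1 hi)
      _ ≤ a k := by
          rw [sum_const, Nat.card_Icc, nsmul_eq_mul, Nat.add_sub_cancel]
          rcases eq_or_ne k 0 with rfl | hk
          · simpa using ha 0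
          · exact (mul_div_cancel₀ _ (Nat.cast_ne_zero.2 hk)).le
  have hswap := hGsum.prod_symm
  refine ⟨_, hswap.prod, fun i K hi => ?_⟩
  refine le_trans (le_of_eq ?_) ((hswap.prod_factor i).sum_le_tsum (Ico i K) fun k _ => hG0 _)
  exact sum_congr rfl fun k hk => (if_pos ⟨hi, (mem_Ico.1 hk).1⟩).symm

theorem eventually_forall_le_nat {l : Filter ℕ} {p : ℕ → ℕ → Prop} (N : ℕ)
    (h : ∀ i, ∀ᶠ n in l, p i n) : ∀ᶠ n in l, ∀ i ≤ N, p i n :=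
  ((Set.finite_le_nat N).eventually_all (l := l) (p := p)).2 fun i _ => h i

/-- Komlós-type theorem: if the truncations converge hereditarily in Cesàro mean to functions with
integrable sum and the sequence is bounded in probability, then a subsequence converges
hereditarily in Cesàro mean to the sum. -/
theorem exists_subseq_cesaro_tendsto_tsum {Ω : Type*} [MeasurableSpace Ω] (μ : Measure Ω)
    [IsFiniteMeasure μ] {f : ℕ → Ω → ℝ} (hmeas : ∀ n, Measurable (f n))
    (hpos : ∀ n ω, 0 ≤ f n ω) {F : ℕ → Ω → ℝ} (hFmeas : ∀ k, Measurable (F k))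
    (hFpos : ∀ k ω, 0 ≤ F k ω)
    (hF : ∀ k, ∀ φ : ℕ → ℕ, StrictMono φ → ∀ᵐ ω ∂μ, Tendsto
      (fun J : ℕ => (∑ j ∈ range J, trunc (f (φ j)) (k + 1) ω) / J) atTop (nhds (F k ω)))
    (hFint : ∫⁻ ω, ∑' k, ENNReal.ofReal (F k ω) ∂μ ≠ ∞)
    (htight : ∀ ε > 0, ∃ K : ℕ, ∀ᶠ n in atTop, μ.real {ω | (K : ℝ) ≤ f n ω} ≤ ε) :
    ∃ n : ℕ → ℕ, StrictMono n ∧ ∀ φ : ℕ → ℕ, StrictMono φ → ∀ᵐ ω ∂μ,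
      Tendsto (fun I : ℕ => (∑ i ∈ range I, f (n (φ i)) ω) / I) atTop
        (nhds (∑' k, F k ω)) := by
  -- the limits are integrable with summable integrals
  have hlinsum : ∑' k, ∫⁻ ω, ENNReal.ofReal (F k ω) ∂μ ≠ ∞ := by
    rwa [← lintegral_tsum fun k => (hFmeas k).ennreal_ofReal.aemeasurable]
  have hFi : ∀ k, Integrable (F k) μ := fun k =>
    ⟨(hFmeas k).aestronglyMeasurable, (hasFiniteIntegral_iff_ofReal (ae_of_all _ (hFpos k))).2
      (ENNReal.ne_top_of_tsum_ne_top hlinsum k).lt_top⟩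
  let a : ℕ → ℝ := fun k => ∫ ω, F k ω ∂μ
  have ha : ∀ k, 0 ≤ a k := fun k => integral_nonneg (hFpos k)
  have hasum : Summable a := by
    refine (ENNReal.summable_toReal hlinsum).congr fun k => ?_
    exact (integral_eq_lintegral_of_nonneg_ae (ae_of_all _ (hFpos k))
      (hFmeas k).aestronglyMeasurable).symm
  have hsummable : ∀ᵐ ω ∂μ, Summable fun k => F k ω := by
    filter_upwards [ae_lt_top (Measurable.tsum fun k => (hFmeas k).ennreal_ofReal) hFint]
      with ω hω
    exact (ENNReal.summable_toReal hω.ne).congr fun k => ENNReal.toReal_ofReal (hFpos k ω)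
  -- the partial sums of the limits
  let S : ℕ → Ω → ℝ := fun i ω => ∑ k ∈ range i, F k ω
  have hSm : ∀ i, Measurable (S i) := fun i => Finset.measurable_fun_sum _ fun k _ => hFmeas k
  have hT : ∀ n i, MemLp (truncBelow (f n) i) 2 μ := fun n i =>
    MemLp.of_bound (measurable_truncBelow (hmeas n) i).aestronglyMeasurable (i : ℝ)
      (ae_of_all _ fun ω => by
        rw [Real.norm_of_nonneg (truncBelow_nonneg (hpos n ω) i)]
        exact truncBelow_le (hpos n ω) i)
  have hTS : ∀ i, ∀ φ : ℕ → ℕ, StrictMono φ → ∀ᵐ ω ∂μ, Tendsto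
      (fun J : ℕ => (∑ j ∈ range J, truncBelow (f (φ j)) i ω) / J) atTop (nhds (S i ω)) := by
    intro i φ hφ
    filter_upwards [ae_all_iff.2 fun k => hF k φ hφ] with ω hω
    refine (tendsto_finsetSum (range i) fun k _ => hω k).congr fun J => ?_
    rw [← sum_div, sum_comm]
    rfl
  have hSle : ∀ i, ∀ᵐ ω ∂μ, S i ω ≤ i := fun i => by
    filter_upwards [hTS i id strictMono_id] with ω hω
    refine le_of_tendsto' hω fun J => ?_
    refine div_le_of_le_mul₀ (by positivity) (by positivity) ?_
    refine (sum_le_sum fun j _ => truncBelow_le (hpos _ ω) i).trans_eq ?_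
    rw [sum_const, card_range, nsmul_eq_mul, mul_comm]
  have hS0 : ∀ i ω, 0 ≤ S i ω := fun i ω => sum_nonneg fun k _ => hFpos k ω
  have hS : ∀ i, MemLp (S i) 2 μ := fun i =>
    MemLp.of_bound (hSm i).aestronglyMeasurable (i : ℝ) <| (hSle i).mono fun ω hω => by
      rwa [Real.norm_of_nonneg (hS0 i ω)]
  have hTSmem : ∀ n i, MemLp (fun ω => truncBelow (f n) i ω - S i ω) 2 μ := fun n i =>
    (hT n i).sub (hS i)
  have hweak : ∀ l, ∀ h : Ω → ℝ, Integrable h μ → Tendsto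
      (fun n => ∫ ω, h ω * (truncBelow (f n) l ω - S l ω) ∂μ) atTop (nhds 0) := by
    intro l h hh
    have := tendsto_integral_mul_of_hereditary_cesaro (μ := μ)
      (g := fun n ω => truncBelow (f n) l ω - S l ω) (G := fun _ => 0)
      (fun n => (hTSmem n l).aestronglyMeasurable) (R := l) (fun n => ?_) (fun φ hφ => ?_) hh
    · simpa using this
    · filter_upwards [hSle l] with ω hω
      have h1 := truncBelow_nonneg (hpos n ω) l
      have h2 := truncBelow_le (hpos n ω) l
      have h3 := hS0 l ω
      exact abs_le.2 ⟨by linarith, by linarith⟩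
    · filter_upwards [hTS l φ hφ] with ω hω
      have h1 := hω.sub_const (S l ω)
      rw [sub_self] at h1
      refine h1.congr' ?_
      filter_upwards [eventually_gt_atTop 0] with J hJ
      have : (J : ℝ) ≠ 0 := Nat.cast_ne_zero.2 hJ.ne'
      rw [sum_sub_distrib, sum_const, card_range, nsmul_eq_mul, sub_div,
        mul_div_cancel_left₀ _ this]
  have hti : ∀ n k, Integrable (trunc (f n) (k + 1)) μ := fun n k =>
    Integrable.of_bound (measurable_trunc (hmeas n) (k + 1)).aestronglyMeasurable ((k : ℝ) + 1)
      (ae_of_all _ fun ω => by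
        rw [Real.norm_of_nonneg (trunc_succ_nonneg (hpos n ω) k)]
        exact trunc_succ_le (hpos n ω) k)
  have htlim : ∀ k, Tendsto (fun n => ∫ ω, trunc (f n) (k + 1) ω ∂μ) atTop (nhds (a k)) := by
    intro k
    have := tendsto_integral_mul_of_hereditary_cesaro (μ := μ)
      (g := fun n => trunc (f n) (k + 1)) (G := F k)
      (fun n => (hti n k).aestronglyMeasurable) (R := (k : ℝ) + 1)
      (fun n => ae_of_all _ fun ω => by
        rw [abs_of_nonneg (trunc_succ_nonneg (hpos n ω) k)]
        exact trunc_succ_le (hpos n ω) k) (hF k) (integrable_const (1 : ℝ))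
    simpa using this
  -- second moments
  have hsq : ∀ i, ∀ᶠ n in atTop, ∫ ω, truncBelow (f n) i ω ^ 2 ∂μ
      ≤ ∑ k ∈ range i, ((k : ℝ) + 1) * a k + 1 := by
    intro i
    have hlim := tendsto_finsetSum (range i) fun k _ => (htlim k).const_mul ((k : ℝ) + 1)
    filter_upwards [hlim.eventually (gt_mem_nhds (lt_add_one _))] with n hn
    refine le_trans ?_ hn.le
    simp_rw [← integral_const_mul]
    rw [← integral_finsetSum _ fun k _ => (hti n k).const_mul _]
    exact integral_mono (hT n i).integrable_sq
      (integrable_finsetSum _ fun k _ => (hti n k).const_mul _)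
      fun ω => truncBelow_sq_le (hpos n ω) i
  -- tail probabilities
  obtain ⟨d, hdsum, hd⟩ := exists_summable_sum_Ico_div_le ha hasum
  have htail : ∀ i : ℕ, 1 ≤ i → ∀ ε > 0, ∀ᶠ n in atTop,
      μ.real {ω | (i : ℝ) ≤ f n ω} ≤ d i + ε := by
    intro i hi ε hε
    obtain ⟨K, hK⟩ := htight (ε / 2) (by positivity)
    have hlim := tendsto_finsetSum (Ico i K) fun k _ => (htlim k).div_const (k : ℝ)
    filter_upwards [hK, hlim.eventually (gt_mem_nhds (lt_add_of_pos_right _ (half_pos hε)))]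
      with n hn1 hn2
    have hmK : MeasurableSet {ω | (K : ℝ) ≤ f n ω} := measurableSet_le measurable_const (hmeas n)
    have hmi : MeasurableSet {ω | (i : ℝ) ≤ f n ω} := measurableSet_le measurable_const (hmeas n)
    have hindi : ∀ s : Set Ω, MeasurableSet s → Integrable (s.indicator fun _ => (1 : ℝ)) μ :=
      fun s hs => (integrable_const 1).indicator hs
    have hsumi : Integrable (fun ω => ∑ k ∈ Ico i K, trunc (f n) (k + 1) ω / k) μ :=
      integrable_finsetSum _ fun k _ => (hti n k).div_const _
    have hle : ∫ ω, ({ω | (i : ℝ) ≤ f n ω}).indicator (fun _ => (1 : ℝ)) ω ∂μ ≤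
        ∫ ω, (∑ k ∈ Ico i K, trunc (f n) (k + 1) ω / k
          + ({ω | (K : ℝ) ≤ f n ω}).indicator (fun _ => (1 : ℝ)) ω) ∂μ := by
      refine integral_mono (hindi _ hmi) (hsumi.add (hindi _ hmK)) fun ω => ?_
      have hf0 := hpos n ω
      have hs0 : ∀ k ∈ Ico i K, 0 ≤ trunc (f n) (k + 1) ω / k := fun k _ =>
        div_nonneg (trunc_succ_nonneg hf0 k) (Nat.cast_nonneg k)
      by_cases hiω : (i : ℝ) ≤ f n ω
      · by_cases hKω : (K : ℝ) ≤ f n ω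
        · simp only [Set.indicator_apply, Set.mem_ofPred_eq, if_pos hiω, if_pos hKω]
          linarith [sum_nonneg hs0]
        · simp only [Set.indicator_apply, Set.mem_ofPred_eq, if_pos hiω, if_neg hKω, add_zero]
          have hfl : i ≤ ⌊f n ω⌋₊ := Nat.le_floor hiω
          have hmem : ⌊f n ω⌋₊ ∈ Ico i K :=
            mem_Ico.2 ⟨hfl, (Nat.floor_lt hf0).2 (not_le.1 hKω)⟩
          refine le_trans ?_ (single_le_sum hs0 hmem)
          rw [trunc_succ_apply hf0, if_pos rfl, le_div_iff₀ (by exact_mod_cast hi.trans hfl),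
            one_mul]
          exact Nat.floor_le hf0
      · simp only [Set.indicator_apply, Set.mem_ofPred_eq, if_neg hiω]
        have := sum_nonneg hs0
        split_ifs <;> linarith
    rw [integral_add hsumi (hindi _ hmK), integral_indicator_const _ hmi,
      integral_indicator_const _ hmK, integral_finsetSum _ fun k _ => (hti n k).div_const _] at hle
    simp_rw [integral_div, smul_eq_mul, mul_one] at hle
    linarith [hd i K hi]
  -- the subsequence
  obtain ⟨ψ, hψ, hψφ⟩ := exists_strictMono_forall_subseq_rel
    (C := fun N n => ∀ l ≤ N + 1, ((∀ i ≤ N + 1,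
        (∀ m ≤ N, |∫ ω, truncBelow (f m) i ω * (truncBelow (f n) l ω - S l ω) ∂μ|
          ≤ 1 / ((N : ℝ) + 1) ^ 2) ∧
        |∫ ω, S i ω * (truncBelow (f n) l ω - S l ω) ∂μ| ≤ 1 / ((N : ℝ) + 1) ^ 2) ∧
      ∫ ω, truncBelow (f n) l ω ^ 2 ∂μ ≤ ∑ k ∈ range l, ((k : ℝ) + 1) * a k + 1) ∧
      (1 ≤ l → μ.real {ω | (l : ℝ) ≤ f n ω} ≤ d l + 1 / ((N : ℝ) + 1) ^ 2))
    (fun N => by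
      have hε : 0 < 1 / ((N : ℝ) + 1) ^ 2 := by positivity
      have habs : ∀ l, ∀ h : Ω → ℝ, Integrable h μ → ∀ᶠ n in atTop,
          |∫ ω, h ω * (truncBelow (f n) l ω - S l ω) ∂μ| ≤ 1 / ((N : ℝ) + 1) ^ 2 :=
        fun l h hh => ((hweak l h hh).abs.eventually (gt_mem_nhds (by simpa using hε))).mono
          fun n hn => hn.le
      refine (eventually_forall_le_nat _ fun l => ?_).frequently
      refine ((eventually_forall_le_nat _ fun i => ?_).and (hsq l)).and ?_
      · exact (eventually_forall_le_nat _ fun m =>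
          habs l _ ((hT m i).integrable one_le_two)).and
            (habs l _ ((hS i).integrable one_le_two))
      · by_cases hl : 1 ≤ l
        · exact (htail l hl _ hε).mono fun n hn _ => hn
        · exact Eventually.of_forall fun n h => absurd h hl)
    (fun M N n hMN h l hl => by
      have hle : 1 / ((N : ℝ) + 1) ^ 2 ≤ 1 / ((M : ℝ) + 1) ^ 2 := by gcongr
      obtain ⟨⟨h1, h2⟩, h3⟩ := h l (by omega)
      refine ⟨⟨fun i hi => ?_, h2⟩, fun hl1 => (h3 hl1).trans (by gcongr)⟩
      obtain ⟨h4, h5⟩ := h1 i (by omega)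
      exact ⟨fun m hm => (h4 m (by omega)).trans hle, h5.trans hle⟩)
  refine ⟨ψ, hψ, fun φ hφ => ?_⟩
  have hle : ∀ j, j ≤ ψ (φ j) := fun j => (hψ.comp hφ).le_apply
  have hεle : ∀ j, 1 / ((ψ (φ j) : ℝ) + 1) ^ 2 ≤ 1 / ((j : ℝ) + 1) ^ 2 := fun j => by
    have : (j : ℝ) ≤ ψ (φ j) := by exact_mod_cast hle j
    gcongr
  have hεle1 : ∀ j : ℕ, 1 / ((j : ℝ) + 1) ^ 2 ≤ 1 / ((j : ℝ) + 1) := fun j => by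
    refine one_div_le_one_div_of_le (by positivity) (le_self_pow₀ ?_ two_ne_zero)
    linarith [(Nat.cast_nonneg j : (0 : ℝ) ≤ j)]
  let W : ℕ → Ω → ℝ := fun i => truncBelow (f (ψ (φ i))) i
  have hmain : ∀ᵐ ω ∂μ, Tendsto (fun I : ℕ => (∑ i ∈ range I, W i ω) / I) atTop
      (nhds (∑' k, F k ω)) := by
    refine ae_tendsto_cesaro_of_integral_sq_le (W := W) (T := S) (L := fun ω => ∑' k, F k ω)
      (e := fun j => ∑ k ∈ range j, ((k : ℝ) + 1) * a k + (3 + 2 * |(2 : ℝ)|))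
      (fun i => hT _ _) hS (fun i ω => truncBelow_nonneg (hpos _ ω) i) ?_ (fun j => ?_) ?_
      fun I => ?_
    · filter_upwards [hsummable] with ω hω using hω.hasSum.tendsto_sum_nat
    · exact add_nonneg (sum_nonneg fun k _ => mul_nonneg (by positivity) (ha k)) (by positivity)
    · have := ((summable_nat_add_iff 1).2 (Real.summable_one_div_nat_pow.2 one_lt_two)).mul_left
        (3 + 2 * |(2 : ℝ)|)
      refine ((summable_sum_range_mul_div_sq ha hasum).add this).congr fun j => ?_
      push_cast
      ring
    · simp_rw [← add_assoc _ (3 : ℝ)]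
      refine integral_sum_sq_le (V := fun i ω => W i ω - S i ω) (fun i => hTSmem _ i)
        (fun j => ?_) (c := 2) (fun i j hij => ?_) I
      · rcases j with _ | j
        · simp [W, S, truncBelow]
        · obtain ⟨⟨h1, h2⟩, -⟩ := hψφ φ hφ j (j + 1) (by have := hle j; omega)
          have h3 := (abs_le.1 ((h1 (j + 1) (by have := hle j; omega)).2)).1
          have h4 : 1 / ((ψ (φ j) : ℝ) + 1) ^ 2 ≤ 1 := (hεle j).trans <|
            (hεle1 j).trans <| by
              rw [div_le_one (by positivity)]
              linarith [(Nat.cast_nonneg j : (0 : ℝ) ≤ j)]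
          have hWS : Integrable
              (fun ω => S (j + 1) ω * (W (j + 1) ω - S (j + 1) ω)) μ :=
            (hS _).integrable_mul (hTSmem _ _)
          have h5 : ∫ ω, (W (j + 1) ω - S (j + 1) ω) ^ 2 ∂μ ≤ ∫ ω, (W (j + 1) ω ^ 2
              - 2 * (S (j + 1) ω * (W (j + 1) ω - S (j + 1) ω))) ∂μ := by
            refine integral_mono (hTSmem _ _).integrable_sq
              ((hT _ _).integrable_sq.sub (hWS.const_mul 2)) fun ω => ?_
            nlinarith [sq_nonneg (S (j + 1) ω)]
          rw [integral_sub (hT _ _).integrable_sq (hWS.const_mul 2), integral_const_mul] at h5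
          simp only [W] at h5 ⊢
          linarith
      · obtain ⟨j, rfl⟩ : ∃ b, j = b + 1 := ⟨j - 1, by omega⟩
        obtain ⟨⟨h1, -⟩, -⟩ := hψφ φ hφ j (j + 1) (by have := hle j; omega)
        obtain ⟨h3, h4⟩ := h1 i (by have := hle j; omega)
        have h3 := h3 (ψ (φ i)) ((hψ.comp hφ).monotone (by omega))
        have h5 := (hεle j).trans (hεle1 j)
        have hi1 : Integrable (fun ω => W i ω * (W (j + 1) ω - S (j + 1) ω)) μ :=
          (hT _ _).integrable_mul (hTSmem _ _)
        have hi2 : Integrable (fun ω => S i ω * (W (j + 1) ω - S (j + 1) ω)) μ :=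
          (hS _).integrable_mul (hTSmem _ _)
        simp_rw [sub_mul]
        rw [integral_sub hi1 hi2]
        calc _ ≤ 1 / ((ψ (φ j) : ℝ) + 1) ^ 2 + 1 / ((ψ (φ j) : ℝ) + 1) ^ 2 :=
              (abs_sub _ _).trans (add_le_add h3 h4)
          _ ≤ 1 / ((j : ℝ) + 1) + 1 / ((j : ℝ) + 1) := add_le_add h5 h5
          _ = _ := by push_cast; ring
  have hBC : ∀ᵐ ω ∂μ, ∀ᶠ j : ℕ in atTop,
      ω ∉ {ω | ((j + 1 : ℕ) : ℝ) ≤ f (ψ (φ (j + 1))) ω} := by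
    refine ae_eventually_notMem ?_
    have hsum : Summable fun j : ℕ => μ.real {ω | ((j + 1 : ℕ) : ℝ) ≤ f (ψ (φ (j + 1))) ω} := by
      refine Summable.of_nonneg_of_le (fun j => measureReal_nonneg) (fun j => ?_)
        (((summable_nat_add_iff 1).2 hdsum).add
          ((summable_nat_add_iff 1).2 (Real.summable_one_div_nat_pow.2 one_lt_two)))
      obtain ⟨-, h⟩ := hψφ φ hφ j (j + 1) (by have := hle j; omega)
      refine (h (by omega)).trans ?_
      have := hεle j
      push_cast
      gcongr
    refine (tsum_congr fun j => ?_).trans_ne hsum.tsum_ofReal_ne_top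
    rw [ofReal_measureReal]
  filter_upwards [hmain, hBC] with ω hω hev
  have hev' : ∀ᶠ i in atTop, 0 = f (ψ (φ i)) ω - W i ω := by
    obtain ⟨N, hN⟩ := eventually_atTop.1 hev
    filter_upwards [eventually_ge_atTop (N + 1)] with i hi
    obtain ⟨j, rfl⟩ : ∃ b, i = b + 1 := ⟨i - 1, by omega⟩
    have := hN j (by omega)
    rw [not_le] at this
    simp only [W]
    rw [truncBelow_apply (hpos _ ω), if_pos this, sub_self]
  have h1 := hω.add (tendsto_const_nhds.congr' hev').cesaro
  rw [add_zero] at h1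
  refine h1.congr fun I => ?_
  rw [sum_sub_distrib]
  ring

/-- **Dichotomy lemma.** Suppose the truncations `f_n^(k)` converge hereditarily in
Cesàro mean to `F k`, set `f = ∑_k F k`, and let `B ⊇ {f = ∞}` be measurable such that
the Cesàro averages along every subsequence tend to `∞` a.e. on `B`. Then either (i) `B`
can be inflated to a set `C` of strictly larger measure on which, along some subsequence
and all its further subsequences, the Cesàro averages tend to `∞` a.e.; or (ii) along
some subsequence and all its further subsequences, the Cesàro averages converge to `f`
a.e. on `Ω \ B`. -/
theorem dichotomy {Ω : Type*} [MeasurableSpace Ω] (P : Measure Ω)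
    [IsProbabilityMeasure P] (f : ℕ → Ω → ℝ)
    (hmeas : ∀ n, Measurable (f n)) (hpos : ∀ n ω, 0 ≤ f n ω)
    (F : ℕ → Ω → ℝ) (hFmeas : ∀ k, Measurable (F k)) (hFpos : ∀ k ω, 0 ≤ F k ω)
    (hF : ∀ k : ℕ, 1 ≤ k → ∀ φ : ℕ → ℕ, StrictMono φ →
      ∀ᵐ ω ∂P, Tendsto
        (fun J : ℕ => (∑ j ∈ Finset.range J, trunc (f (φ j)) k ω) / J)
        atTop (nhds (F k ω)))
    (B : Set Ω) (hB : MeasurableSet B)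
    (hBsup : {ω | (∑' k : ℕ, ENNReal.ofReal (F (k + 1) ω)) = ⊤} ⊆ B)
    (hBinf : ∀ φ : ℕ → ℕ, StrictMono φ →
      ∀ᵐ ω ∂P, ω ∈ B →
        Tendsto (fun J : ℕ => (∑ j ∈ Finset.range J, f (φ j) ω) / J) atTop atTop) :
    (∃ C : Set Ω, MeasurableSet C ∧ B ⊆ C ∧ P B < P C ∧
        ∃ n : ℕ → ℕ, StrictMono n ∧
          ∀ φ : ℕ → ℕ, StrictMono φ →
            ∀ᵐ ω ∂P, ω ∈ C →
              Tendsto (fun I : ℕ => (∑ i ∈ Finset.range I, f (n (φ i)) ω) / I)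
                atTop atTop) ∨
      (∃ n : ℕ → ℕ, StrictMono n ∧
        ∀ φ : ℕ → ℕ, StrictMono φ →
          ∀ᵐ ω ∂P, ω ∉ B →
            Tendsto
              (fun I : ℕ =>
                ENNReal.ofReal ((∑ i ∈ Finset.range I, f (n (φ i)) ω) / I))
              atTop (nhds (∑' k : ℕ, ENNReal.ofReal (F (k + 1) ω)))) := by
  let g : Ω → ℝ≥0∞ := fun ω => ∑' k : ℕ, ENNReal.ofReal (F (k + 1) ω)
  have hg : Measurable g := Measurable.tsum fun k => (hFmeas (k + 1)).ennreal_ofReal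
  by_cases htight : ∀ ε > 0, ∃ K : ℕ, ∀ᶠ n in atTop,
      P.real (Bᶜ ∩ {ω | (K : ℝ) ≤ f n ω}) ≤ ε
  · right
    let w : Ω → ℝ≥0∞ := Bᶜ.indicator fun ω => (1 + g ω)⁻¹
    have hw : Measurable w := (measurable_const.add hg).inv.indicator hB.compl
    have hw1 : ∀ ω, w ω ≤ Bᶜ.indicator (fun _ => 1) ω := fun ω =>
      Set.indicator_le_indicator (ENNReal.inv_le_one.2 le_self_add)
    let Q : Measure Ω := P.withDensity w
    have hQle : ∀ s, MeasurableSet s → Q s ≤ P (Bᶜ ∩ s) := fun s hs => by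
      rw [withDensity_apply _ hs]
      refine (lintegral_mono hw1).trans_eq ?_
      rw [lintegral_indicator_const hB.compl, one_mul, Measure.restrict_apply hB.compl]
    have hQfin : IsFiniteMeasure Q :=
      ⟨(hQle _ MeasurableSet.univ).trans_lt (measure_lt_top _ _)⟩
    have hQint : ∫⁻ ω, g ω ∂Q ≠ ∞ := by
      rw [lintegral_withDensity_eq_lintegral_mul _ hw hg]
      refine ((lintegral_mono fun ω => ?_).trans_lt
        (IsFiniteMeasure.lintegral_lt_top_of_bounded_to_ennreal P
          (f := fun _ => 1) ⟨1, fun _ => le_rfl⟩)).ne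
      by_cases hω : ω ∈ B
      · simp [w, hω]
      · have hle : (1 + g ω)⁻¹ * g ω ≤ 1 := by
          rw [mul_comm, ← div_eq_mul_inv]
          exact ENNReal.div_le_of_le_mul (by rw [one_mul]; exact le_add_self)
        simpa [w, hω] using hle
    obtain ⟨n, hn, hnφ⟩ := exists_subseq_cesaro_tendsto_tsum Q hmeas hpos
      (F := fun k => F (k + 1)) (fun k => hFmeas _) (fun k => hFpos _)
      (fun k φ hφ => (withDensity_absolutelyContinuous P w).ae_le (hF (k + 1) (by omega) φ hφ))
      hQint (fun ε hε => by
        obtain ⟨K, hK⟩ := htight ε hε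
        refine ⟨K, hK.mono fun n hn => le_trans ?_ hn⟩
        exact ENNReal.toReal_mono (measure_ne_top _ _)
          (hQle _ (measurableSet_le measurable_const (hmeas n))))
    refine ⟨n, hn, fun φ hφ => ?_⟩
    filter_upwards [(ae_withDensity_iff hw).1 (hnφ φ hφ)] with ω hω hωB
    have hgω : g ω ≠ ∞ := fun h => hωB (hBsup h)
    have hsum : Summable fun k => F (k + 1) ω :=
      (ENNReal.summable_toReal hgω).congr fun k => ENNReal.toReal_ofReal (hFpos _ ω)
    rw [← ENNReal.ofReal_tsum_of_nonneg (fun k => hFpos (k + 1) ω) hsum]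
    refine ENNReal.tendsto_ofReal (hω ?_)
    simp [w, hωB, hgω]
  · left
    push Not at htight
    obtain ⟨ε, hε, hK⟩ := htight
    obtain ⟨D, hD, hDpos, n, hn, hnφ⟩ := exists_subseq_cesaro_tendsto_atTop P hmeas hpos
      hB.compl hε fun K => (hK K).mono fun n hn => hn.le
    refine ⟨B ∪ D, hB.union hD, Set.subset_union_left, ?_, n, hn, fun φ hφ => ?_⟩
    · rw [← Set.union_sdiff_self, measure_union Set.disjoint_sdiff_right (hD.diff hB),
        Set.sdiff_eq, Set.inter_comm]
      exact ENNReal.lt_add_right (measure_ne_top _ _) hDpos.ne'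
    · filter_upwards [hnφ φ hφ, hBinf (n ∘ φ) (hn.comp hφ)] with ω h1 h2 hω
      exact hω.elim h2 h1
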